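/- Let V be a finite-dimensional real vector space with a nondegenerate symmetric bilinear form g, let A be a g-symmetric endomorphism of V (g(Ax,y) = g(x,Ay) for all x,y), and let q(t) = Σ_{k=0}^N a_k t^k be a real polynomial. Define the operator R̃_{q,A} on endomorphisms of V by R̃_{q,A}(X) = Σ_{k=1}^N a_k Σ_{r+s=k−1} A^s X A^r. Then R̃_{q,A} satisfies the first Bianchi identity: for all x, y, z ∈ V, R̃_{q,A}(x∧y)z + R̃_{q,A}(z∧x)y + R̃_{q,A}(y∧z)x = 0, where x∧y denotes the endomorphism v ↦ g(x,v)y − g(y,v)x. -/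

import Mathlib

open Finset Polynomial

noncomputable section

/-- The endomorphism `x∧y : v ↦ g(x,v)y − g(y,v)x`. -/
def wedge {V : Type*} [AddCommGroup V] [Module ℝ V]
    (g : V →ₗ[ℝ] V →ₗ[ℝ] ℝ) (x y : V) : Module.End ℝ V :=
  (g x).smulRight y - (g y).smulRight x

/-- The operator `R̃_{q,A}(X) = Σ_{k=1}^N a_k Σ_{r+s=k−1} A^s X A^r`. -/
def Rtilde {V : Type*} [AddCommGroup V] [Module ℝ V]
    (q : Polynomial ℝ) (A X : Module.End ℝ V) : Module.End ℝ V :=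
  ∑ k ∈ Finset.range (q.natDegree + 1), q.coeff k •
    ∑ r ∈ Finset.range k, A ^ (k - 1 - r) * X * A ^ r

lemma apply_pow_swap {R V : Type*} [CommSemiring R] [AddCommMonoid V] [Module R V]
    {g : V →ₗ[R] V →ₗ[R] R} (hgsymm : ∀ x y : V, g x y = g y x)
    {A : Module.End R V} (hAg : ∀ x y : V, g (A x) y = g x (A y)) (r : ℕ) (x y : V) :
    g x ((A ^ r) y) = g y ((A ^ r) x) := by
  induction r generalizing x y with
  | zero => exact hgsymm x y
  | succ r ih =>
    rw [pow_succ', Module.End.mul_apply, ← hAg, ih, ← pow_succ', pow_succ, Module.End.mul_apply]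

/-- `R̃_{q,A}` satisfies the first Bianchi identity:
`R̃_{q,A}(x∧y)z + R̃_{q,A}(z∧x)y + R̃_{q,A}(y∧z)x = 0`. -/
theorem stmt9
    (V : Type*) [AddCommGroup V] [Module ℝ V] [FiniteDimensional ℝ V]
    (g : V →ₗ[ℝ] V →ₗ[ℝ] ℝ)
    (hgsymm : ∀ x y : V, g x y = g y x)
    (hgnd : ∀ x : V, (∀ y : V, g x y = 0) → x = 0)
    (A : Module.End ℝ V)
    (hAg : ∀ x y : V, g (A x) y = g x (A y))
    (q : Polynomial ℝ) :
    ∀ x y z : V,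
      Rtilde q A (wedge g x y) z + Rtilde q A (wedge g z x) y
        + Rtilde q A (wedge g y z) x = 0 := by
  intro x y z
  simp only [Rtilde, wedge, LinearMap.sum_apply, LinearMap.smul_apply, Module.End.mul_apply,
    LinearMap.sub_apply, LinearMap.smulRight_apply, map_sub, map_smul]
  rw [← Finset.sum_add_distrib, ← Finset.sum_add_distrib]
  refine Finset.sum_eq_zero fun k _ => ?_
  rw [← smul_add, ← smul_add, ← Finset.sum_add_distrib, ← Finset.sum_add_distrib]
  refine smul_eq_zero_of_right _ (Finset.sum_eq_zero fun r _ => ?_)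
  rw [apply_pow_swap hgsymm hAg r x z, apply_pow_swap hgsymm hAg r y z,
    apply_pow_swap hgsymm hAg r x y]
  abel
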